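/- Let n ≥ 1, let X ⊂ ℝⁿ be open and bounded, let Y ⊂ ℝⁿ be open, bounded and convex, let a₀ ∈ ℝ, y₀ ∈ Y, and let q > 1 and δ > 0. Let F¹ : X × ℝⁿ → ℝ be C² and F⁰ : X × ℝ → ℝ be C¹, and assume: (H1) for every x ∈ X the map p ↦ F¹(x,p) is (q,δ)-strongly convex on Y; (H2) there is a locally bounded function η : ℝ → ℝ with |∂_z F⁰(x,z)| ≤ η(z) for all x ∈ X, z ∈ ℝ; (H3) there is a locally bounded function g on Y with |D_p F¹(x,p)| ≤ g(p) and |∂²F¹/∂x_i∂p_i (x,p)| ≤ g(p) for all x ∈ X, p ∈ Y and every index i. If u belongs to the admissible class U₀ and minimizes L(v) = ∫_X [ F¹(x, ∇v(x)) + F⁰(x, v(x)) ] dx over U₀, then u ∈ C^{1,α}_loc(X) with α = 1/(q−1) when q > 2 and α = 1 when 1 < q ≤ 2; that is, u is differentiable on X and ∇u is locally α-Hölder continuous. -/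

import Mathlib

open MeasureTheory RealInnerProductSpace

/-- The subdifferential of `v` at `x`, relative to the set `X`. -/
def subgrad {n : ℕ} (X : Set (EuclideanSpace ℝ (Fin n)))
    (v : EuclideanSpace ℝ (Fin n) → ℝ) (x : EuclideanSpace ℝ (Fin n)) :
    Set (EuclideanSpace ℝ (Fin n)) :=
  {p | ∀ z ∈ X, v x + ⟪p, z - x⟫ ≤ v z}

/-- The admissible class `U₀`. -/
def admissible {n : ℕ} (X Y : Set (EuclideanSpace ℝ (Fin n))) (a₀ : ℝ)
    (y₀ : EuclideanSpace ℝ (Fin n)) (v : EuclideanSpace ℝ (Fin n) → ℝ) : Prop :=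
  ConvexOn ℝ X v ∧ (∀ x ∈ X, subgrad X v x ⊆ closure Y) ∧
    ∀ x ∈ X, a₀ + ⟪x, y₀⟫ ≤ v x

/-- The functional `L(v) = ∫_X [F¹(x, ∇v(x)) + F⁰(x, v(x))] dx`,
where `∇v` is the (a.e. defined) gradient of `v`. -/
noncomputable def funcL {n : ℕ} (X : Set (EuclideanSpace ℝ (Fin n)))
    (F1 : EuclideanSpace ℝ (Fin n) → EuclideanSpace ℝ (Fin n) → ℝ)
    (F0 : EuclideanSpace ℝ (Fin n) → ℝ → ℝ)
    (v : EuclideanSpace ℝ (Fin n) → ℝ) : ℝ :=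
  ∫ x in X, (F1 x (gradient v x) + F0 x (v x))

open Filter Topology Set

section Subgradients

variable {n : ℕ} {X Y : Set (EuclideanSpace ℝ (Fin n))} {u : EuclideanSpace ℝ (Fin n) → ℝ}

/-- A convex function on an open set has a subgradient at every point. -/
lemma subgrad_nonempty (hXo : IsOpen X) (hu : ConvexOn ℝ X u) {x : EuclideanSpace ℝ (Fin n)}
    (hx : x ∈ X) : (subgrad X u x).Nonempty := by
  have hopen : IsOpen {p : EuclideanSpace ℝ (Fin n) × ℝ | p.1 ∈ X ∧ u p.1 < p.2} := by
    rw [isOpen_iff_mem_nhds]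
    rintro ⟨z, t⟩ ⟨hz, ht⟩
    have h1 : ∀ᶠ p : EuclideanSpace ℝ (Fin n) × ℝ in 𝓝 (z, t), p.1 ∈ X :=
      continuous_fst.continuousAt.eventually (hXo.mem_nhds hz)
    have hc : ContinuousAt u z := (hu.continuousOn hXo).continuousAt (hXo.mem_nhds hz)
    have h2 : ContinuousAt (fun p : EuclideanSpace ℝ (Fin n) × ℝ => u p.1) (z, t) :=
      ContinuousAt.comp (f := Prod.fst) (g := u) (x := (z, t)) hc continuous_fst.continuousAt
    exact h1.and (h2.eventually_lt continuous_snd.continuousAt ht)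
  obtain ⟨f, hf⟩ := geometric_hahn_banach_point_open hu.convex_strict_epigraph hopen
    (x := (x, u x)) (by simp)
  set φ : EuclideanSpace ℝ (Fin n) →L[ℝ] ℝ := f.comp (ContinuousLinearMap.inl ℝ _ _)
  set c : ℝ := f (0, 1)
  have hfeq : ∀ z t, f (z, t) = φ z + t * c := by
    intro z t
    have : ((z, t) : EuclideanSpace ℝ (Fin n) × ℝ) = (z, 0) + t • (0, 1) := by simp
    rw [this, map_add, map_smul]; rfl
  have hc : 0 < c := by
    have := hf (x, u x + 1) ⟨hx, by simp⟩
    rw [hfeq, hfeq] at this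
    linarith
  have key : ∀ z ∈ X, φ x + u x * c ≤ φ z + u z * c := by
    intro z hz
    refine le_of_forall_pos_le_add fun ε hε => ?_
    have := hf (z, u z + ε / c) ⟨hz, by simp; positivity⟩
    rw [hfeq, hfeq, add_mul, div_mul_cancel₀ _ hc.ne'] at this
    linarith
  refine ⟨(InnerProductSpace.toDual ℝ _).symm (-c⁻¹ • φ), fun z hz => ?_⟩
  rw [InnerProductSpace.toDual_symm_apply]
  have h := key z hz
  have h2 : (-c⁻¹ • φ) (z - x) = (φ x - φ z) / c := by
    simp [map_sub]; field_simp; ring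
  rw [h2, ← le_sub_iff_add_le', div_le_iff₀ hc]
  linarith

/-- A gradient of a convex function on an open set is a subgradient. -/
lemma gradient_mem_subgrad (hu : ConvexOn ℝ X u)
    {x : EuclideanSpace ℝ (Fin n)} (hx : x ∈ X) (hd : DifferentiableAt ℝ u x) :
    gradient u x ∈ subgrad X u x := by
  intro z hz
  have hline : HasDerivAt (fun t : ℝ => u (x + t • (z - x))) ⟪gradient u x, z - x⟫ 0 := by
    have h1 : HasFDerivAt u (fderiv ℝ u x) (x + (0 : ℝ) • (z - x)) := by
      simpa using hd.hasFDerivAt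
    have h2 : HasDerivAt (fun t : ℝ => x + t • (z - x)) (z - x) 0 := by
      simpa using ((hasDerivAt_id (0 : ℝ)).smul_const (z - x)).const_add x
    rw [inner_gradient_left]
    exact h1.comp_hasDerivAt 0 h2
  have hslope := hline.tendsto_slope_zero_right
  refine le_sub_iff_add_le'.mp (le_of_tendsto hslope ?_)
  filter_upwards [Ioo_mem_nhdsGT (zero_lt_one' ℝ)] with t ht
  have hcv := hu.2 hx hz (sub_nonneg.2 ht.2.le) ht.1.le (by ring)
  have he : (1 - t) • x + t • z = x + t • (z - x) := by module
  rw [he] at hcv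
  simp only [zero_add, zero_smul, add_zero, smul_eq_mul] at hcv ⊢
  rw [inv_mul_le_iff₀ ht.1]
  linarith

/-- Increments of an admissible function are controlled by linear functionals on `Y`. -/
lemma sub_le_of_subgrad_subset (hXo : IsOpen X) (hu : ConvexOn ℝ X u)
    (hs : ∀ x ∈ X, subgrad X u x ⊆ closure Y) {x z : EuclideanSpace ℝ (Fin n)} (hx : x ∈ X)
    (hz : z ∈ X) {M : ℝ} (hM : ∀ y ∈ closure Y, ⟪y, z - x⟫ ≤ M) : u z - u x ≤ M := by
  obtain ⟨p, hp⟩ := subgrad_nonempty hXo hu hz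
  have h1 := hp x hx
  have h2 := hM p (hs z hz hp)
  rw [← neg_sub z x, inner_neg_right] at h1
  linarith

/-- If all increments of `v` are controlled by linear functionals on the convex set `Y`, then the
subgradients of `v` lie in the closure of `Y`. -/
lemma subgrad_subset_closure (hXo : IsOpen X) (hYc : Convex ℝ Y)
    {v : EuclideanSpace ℝ (Fin n) → ℝ}
    (hv : ∀ x ∈ X, ∀ z ∈ X, ∀ M : ℝ, (∀ y ∈ closure Y, ⟪y, z - x⟫ ≤ M) → v z - v x ≤ M)
    {x : EuclideanSpace ℝ (Fin n)} (hx : x ∈ X) : subgrad X v x ⊆ closure Y := by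
  intro m hm
  by_contra hmY
  obtain ⟨f, s, hfs, hsm⟩ := geometric_hahn_banach_closed_point hYc.closure isClosed_closure hmY
  set ω := (InnerProductSpace.toDual ℝ _).symm f
  have hω : ∀ y, f y = ⟪y, ω⟫ := fun y => by
    rw [real_inner_comm, InnerProductSpace.toDual_symm_apply]
  have hcont : Tendsto (fun t : ℝ => x + t • ω) (𝓝[>] 0) (𝓝 x) := by
    have : Continuous (fun t : ℝ => x + t • ω) := by fun_prop
    simpa using (this.tendsto 0).mono_left nhdsWithin_le_nhds
  obtain ⟨t, htX, ht⟩ := ((hcont.eventually (hXo.mem_nhds hx)).and self_mem_nhdsWithin).exists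
  have ht : 0 < t := ht
  have h1 := hm _ htX
  have h2 := hv x hx _ htX (t * s) fun y hy => by
    rw [add_sub_cancel_left, inner_smul_right, ← hω]
    exact mul_le_mul_of_nonneg_left (hfs y hy).le ht.le
  rw [add_sub_cancel_left, inner_smul_right, ← hω] at h1
  nlinarith

/-- An admissible function is Lipschitz. -/
lemma lipschitzOnWith_of_subgrad_subset (hXo : IsOpen X) (hu : ConvexOn ℝ X u)
    (hs : ∀ x ∈ X, subgrad X u x ⊆ closure Y) {R : NNReal} (hR : ∀ y ∈ closure Y, ‖y‖ ≤ R) :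
    LipschitzOnWith R u X := by
  refine LipschitzOnWith.of_le_add_mul R fun x hx z hz => ?_
  rw [← sub_le_iff_le_add']
  refine sub_le_of_subgrad_subset hXo hu hs hz hx fun y hy => ?_
  rw [dist_eq_norm]
  exact (real_inner_le_norm _ _).trans (by gcongr; exact hR y hy)

/-- The maximum of an admissible function and an affine function with slope in `closure Y` is
admissible. -/
lemma admissible_max {a₀ : ℝ} {y₀ : EuclideanSpace ℝ (Fin n)} (hXo : IsOpen X)
    (hYc : Convex ℝ Y) (hu : admissible X Y a₀ y₀ u) {p : EuclideanSpace ℝ (Fin n)}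
    (hp : p ∈ closure Y) (b : ℝ) : admissible X Y a₀ y₀ (fun x => max (u x) (⟪p, x⟫ + b)) := by
  obtain ⟨hc, hs, hl⟩ := hu
  refine ⟨?_, ?_, fun x hx => (hl x hx).trans (le_max_left _ _)⟩
  · refine ConvexOn.sup hc (ConvexOn.add_const ?_ b)
    exact (innerₗ _ p).convexOn hc.1
  · intro x hx
    refine subgrad_subset_closure hXo hYc (fun x hx z hz M hM => ?_) hx
    have h1 := sub_le_of_subgrad_subset hXo hc hs hx hz hM
    have h2 := hM p hp
    rw [inner_sub_right] at h2
    have h3 := le_max_left (u x) (⟪p, x⟫ + b)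
    have h4 := le_max_right (u x) (⟪p, x⟫ + b)
    rw [sub_le_iff_le_add]
    refine max_le ?_ ?_ <;> linarith

end Subgradients

section Flux

variable {E : Type*} [NormedAddCommGroup E] [InnerProductSpace ℝ E] [FiniteDimensional ℝ E]
  [MeasurableSpace E] [BorelSpace E] (μ : Measure E) [μ.IsAddHaarMeasure]


/-- A map that is `K`-Lipschitz on `A` increases Haar measure at most by the factor `K ^ dim`. -/
lemma addHaar_image_le_of_lipschitzOnWith {K : NNReal} {g : E → E} {A : Set E}
    (hg : LipschitzOnWith K g A) : μ (g '' A) ≤ (K : ENNReal) ^ Module.finrank ℝ E * μ A := by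
  rw [Measure.isAddLeftInvariant_eq_smul μ (μH[Module.finrank ℝ E] : Measure E)]
  have h := hg.hausdorffMeasure_image_le (d := Module.finrank ℝ E) (by positivity)
  rw [ENNReal.rpow_natCast] at h
  simp only [Measure.smul_apply]
  rw [mul_smul_comm]
  gcongr

/-- Change of variables inequality for a map of `X` into itself whose inverse is Lipschitz. -/
lemma setIntegral_comp_le_of_expanding {X : Set E}
    {T : E → E} (hT : Continuous T) (hTX : MapsTo T X X) {K : NNReal}
    (hK : ∀ x ∈ X, ∀ y ∈ X, dist x y ≤ K * dist (T x) (T y)) {W : E → ℝ} (hWc : Continuous W)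
    (hW0 : ∀ x, 0 ≤ W x) (hWi : IntegrableOn W X μ) :
    ∫ x in X, W (T x) ∂μ ≤ (K : ℝ) ^ Module.finrank ℝ E * ∫ x in X, W x ∂μ := by
  set N := Module.finrank ℝ E
  have hinj : InjOn T X := fun x hx y hy hxy => by
    have := hK x hx y hy
    rw [hxy, dist_self, mul_zero] at this
    exact dist_le_zero.1 this
  have hle : Measure.map T (μ.restrict X) ≤ (K ^ N) • μ.restrict X := by
    refine Measure.le_iff.2 fun s hs => ?_
    rw [Measure.map_apply hT.measurable hs, Measure.restrict_apply (hT.measurable hs),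
      Measure.smul_apply, Measure.restrict_apply hs]
    have hinv : LipschitzOnWith K (Function.invFunOn T X) (T '' X) := by
      refine LipschitzOnWith.of_dist_le_mul ?_
      rintro _ ⟨x, hx, rfl⟩ _ ⟨y, hy, rfl⟩
      rw [hinj.leftInvOn_invFunOn hx, hinj.leftInvOn_invFunOn hy]
      exact hK x hx y hy
    have hsub : T ⁻¹' s ∩ X ⊆ Function.invFunOn T X '' (s ∩ T '' X) := by
      rintro x ⟨hxs, hx⟩
      exact ⟨T x, ⟨hxs, x, hx, rfl⟩, hinj.leftInvOn_invFunOn hx⟩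
    calc μ (T ⁻¹' s ∩ X) ≤ μ (Function.invFunOn T X '' (s ∩ T '' X)) := measure_mono hsub
      _ ≤ (K : ENNReal) ^ N * μ (s ∩ T '' X) :=
        addHaar_image_le_of_lipschitzOnWith μ (hinv.mono inter_subset_right)
      _ ≤ (K : ENNReal) ^ N * μ (s ∩ X) := by
        gcongr
        exact hTX.image_subset
      _ = (K ^ N) • μ (s ∩ X) := by
        rw [ENNReal.smul_def, smul_eq_mul, ENNReal.coe_pow]
  have hint : Integrable W ((K ^ N) • μ.restrict X) := hWi.smul_measure_nnreal
  calc ∫ x in X, W (T x) ∂μ = ∫ y, W y ∂(Measure.map T (μ.restrict X)) :=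
        (integral_map hT.aemeasurable hWc.aestronglyMeasurable).symm
    _ ≤ ∫ y, W y ∂((K ^ N) • μ.restrict X) :=
        integral_mono_measure hle (Eventually.of_forall hW0) hint
    _ = (K : ℝ) ^ N * ∫ x in X, W x ∂μ := by
        rw [integral_smul_nnreal_measure, NNReal.smul_def, smul_eq_mul, NNReal.coe_pow]

/-- Integration by parts inequality on a convex domain: the outward pointing field
`κ • (x - x₀)` compensates the boundary terms of `V`. -/
lemma setIntegral_inner_gradient_le {X : Set E} (hXo : IsOpen X) (hXb : Bornology.IsBounded X)
    (hXc : Convex ℝ X) {x₀ : E} {d : ℝ} (hd : Metric.ball x₀ d ⊆ X) {V : E → E}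
    (hV : Continuous V) {L : NNReal} (hVL : LipschitzOnWith L V X) {κ : ℝ} (hκ : 0 < κ)
    (hVκ : ∀ x ∈ X, ‖V x‖ < κ * d) {W : E → ℝ} {R : NNReal} (hW : LipschitzWith R W)
    (hW0 : ∀ x, 0 ≤ W x) :
    ∫ x in X, ⟪gradient W x, V x - κ • (x - x₀)⟫ ∂μ ≤
      Module.finrank ℝ E * (κ + L) * ∫ x in X, W x ∂μ := by
  set N := Module.finrank ℝ E
  set B : ℝ := κ + L
  have hB : 0 < B := by positivity
  set Z : E → E := fun x => V x - κ • (x - x₀)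
  have hZ : Continuous Z := by fun_prop
  have : IsFiniteMeasure (μ.restrict X) := ⟨by simpa using hXb.measure_lt_top⟩
  have hcpt : IsCompact (closure X) := hXb.isCompact_closure
  have hint : ∀ f : E → ℝ, Continuous f → IntegrableOn f X μ := fun f hf =>
    (hf.continuousOn.integrableOn_compact hcpt).mono_set subset_closure
  obtain ⟨BZ, hBZ⟩ := hcpt.exists_bound_of_continuousOn hZ.continuousOn
  have hlim : Tendsto (fun t : ℝ => ∫ x in X, t⁻¹ * (W (x + t • Z x) - W x) ∂μ) (𝓝[>] 0)
      (𝓝 (∫ x in X, ⟪gradient W x, Z x⟫ ∂μ)) := by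
    refine tendsto_integral_filter_of_dominated_convergence (fun _ => R * BZ) ?_ ?_ ?_ ?_
    · refine Eventually.of_forall fun t => Continuous.aestronglyMeasurable ?_
      have := hW.continuous
      fun_prop
    · filter_upwards [self_mem_nhdsWithin] with t ht
      have ht : 0 < t := ht
      filter_upwards [ae_restrict_mem hXo.measurableSet] with x hx
      have h1 := hW.dist_le_mul (x + t • Z x) x
      rw [dist_eq_norm, dist_eq_norm, add_sub_cancel_left, norm_smul, Real.norm_of_nonneg ht.le]
        at h1
      rw [norm_mul, norm_inv, Real.norm_of_nonneg ht.le, inv_mul_le_iff₀ ht]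
      refine h1.trans ?_
      have := hBZ x (subset_closure hx)
      calc (R : ℝ) * (t * ‖Z x‖) ≤ R * (t * BZ) := by gcongr
        _ = t * (R * BZ) := by ring
    · exact integrable_const _
    · filter_upwards [ae_restrict_of_ae (hW.ae_differentiableAt (μ := μ))] with x hx
      have h1 : HasFDerivAt W (fderiv ℝ W x) (x + (0 : ℝ) • Z x) := by
        simpa using hx.hasFDerivAt
      have h2 : HasDerivAt (fun t : ℝ => x + t • Z x) (Z x) 0 := by
        simpa using ((hasDerivAt_id (0 : ℝ)).smul_const (Z x)).const_add x
      rw [inner_gradient_left]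
      simpa using (h1.comp_hasDerivAt 0 h2).tendsto_slope_zero_right
  have hlim2 : Tendsto (fun t : ℝ => t⁻¹ * (((1 - t * B)⁻¹) ^ N - 1) * ∫ x in X, W x ∂μ) (𝓝[>] 0)
      (𝓝 (N * B * ∫ x in X, W x ∂μ)) := by
    refine Tendsto.mul_const _ ?_
    have h0 : HasDerivAt (fun t : ℝ => 1 - t * B) (-B) 0 := by
      simpa using ((hasDerivAt_id (0 : ℝ)).mul_const B).const_sub 1
    have h1 : HasDerivAt (fun t : ℝ => ((1 - t * B)⁻¹) ^ N) (N * B) 0 := by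
      simpa using (h0.fun_inv (by simp)).fun_pow N
    simpa using h1.tendsto_slope_zero_right
  refine le_of_tendsto_of_tendsto hlim hlim2 ?_
  have hpos : 0 < min κ⁻¹ B⁻¹ := by positivity
  filter_upwards [Ioo_mem_nhdsGT hpos] with t ht
  obtain ⟨ht0, ht1⟩ := ht
  have htκ : t * κ < 1 := by
    have := ht1.trans_le (min_le_left _ _)
    rwa [← one_div, lt_div_iff₀ hκ] at this
  have htB : t * B < 1 := by
    have := ht1.trans_le (min_le_right _ _)
    rwa [← one_div, lt_div_iff₀ hB] at this
  have hmaps : MapsTo (fun x => x + t • Z x) X X := by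
    intro x hx
    have hmem : x₀ + κ⁻¹ • V x ∈ X := by
      apply hd
      rw [mem_ball_iff_norm, add_sub_cancel_left, norm_smul, norm_inv, Real.norm_of_nonneg hκ.le,
        inv_mul_lt_iff₀ hκ]
      exact hVκ x hx
    have := hXc hx hmem (sub_nonneg.2 htκ.le) (mul_nonneg ht0.le hκ.le) (by ring)
    convert this using 1
    have h3 : (t * κ) • κ⁻¹ • V x = t • V x := by
      rw [smul_smul, mul_assoc, mul_inv_cancel₀ hκ.ne', mul_one]
    rw [smul_add, h3]
    simp only [Z]
    module
  have hKpos : 0 < 1 - t * B := by linarith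
  have hexp : ∀ x ∈ X, ∀ y ∈ X,
      dist x y ≤ (Real.toNNReal (1 - t * B)⁻¹ : NNReal) * dist (x + t • Z x) (y + t • Z y) := by
    intro x hx y hy
    rw [Real.coe_toNNReal _ (by positivity), inv_mul_eq_div, le_div_iff₀ hKpos]
    have h1 := hVL.dist_le_mul x hx y hy
    simp only [dist_eq_norm] at h1 ⊢
    have h2 : x - y = (x + t • Z x - (y + t • Z y)) - t • (V x - V y) + (t * κ) • (x - y) := by
      simp only [Z]; module
    have h3 : ‖x - y‖ ≤ ‖x + t • Z x - (y + t • Z y)‖ + t * ‖V x - V y‖ + (t * κ) * ‖x - y‖ := by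
      conv_lhs => rw [h2]
      refine (norm_add_le _ _).trans ?_
      rw [norm_smul (t * κ), Real.norm_of_nonneg (by positivity : 0 ≤ t * κ)]
      gcongr
      refine (norm_sub_le _ _).trans ?_
      rw [norm_smul t (V x - V y), Real.norm_of_nonneg ht0.le]
    have h4 : t * ‖V x - V y‖ ≤ t * (L * ‖x - y‖) := by gcongr
    have h5 : ‖x - y‖ * (1 - t * B) = ‖x - y‖ - t * κ * ‖x - y‖ - t * (L * ‖x - y‖) := by
      simp only [B]; ring
    linarith
  have hmain := setIntegral_comp_le_of_expanding μ
    (T := fun x => x + t • Z x) (by fun_prop) hmaps hexp hW.continuous hW0 (hint W hW.continuous)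
  rw [Real.coe_toNNReal _ (by positivity)] at hmain
  have hWT : IntegrableOn (fun x => W (x + t • Z x)) X μ := hint _ <| by
    have := hW.continuous
    fun_prop
  rw [integral_const_mul, integral_sub hWT (hint W hW.continuous), mul_assoc, sub_mul, one_mul]
  gcongr

end Flux

section GradientBounds

variable {E : Type*} [NormedAddCommGroup E] [InnerProductSpace ℝ E] [FiniteDimensional ℝ E]

lemma norm_gradient_le_of_lipschitz {W : E → ℝ} {R : NNReal} (hW : LipschitzWith R W) (x : E) :
    ‖gradient W x‖ ≤ R := by
  rw [gradient, LinearIsometryEquiv.norm_map]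
  exact norm_fderiv_le_of_lipschitz ℝ hW

variable [MeasurableSpace E] [BorelSpace E]

lemma measurable_gradient (W : E → ℝ) : Measurable (gradient W) :=
  (LinearIsometryEquiv.continuous _).measurable.comp (measurable_fderiv ℝ W)

variable (μ : Measure E) [μ.IsAddHaarMeasure]

lemma integrableOn_norm_gradient_rpow {W : E → ℝ} {R : NNReal} (hW : LipschitzWith R W) {q : ℝ}
    (hq : 0 ≤ q) {X : Set E} (hXb : Bornology.IsBounded X) :
    IntegrableOn (fun x => ‖gradient W x‖ ^ q) X μ := by
  have : IsFiniteMeasure (μ.restrict X) := ⟨by simpa using hXb.measure_lt_top⟩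
  refine Integrable.of_bound
    ((measurable_gradient W).norm.pow_const q).aestronglyMeasurable ((R : ℝ) ^ q)
    (Eventually.of_forall fun x => ?_)
  rw [Real.norm_of_nonneg (by positivity)]
  gcongr
  exact norm_gradient_le_of_lipschitz hW x

/-- If `W` drops by at least `2 * l * ρ` over a distance `ρ` in the direction `e`, from every point
of `A`, then the `q`-energy of `W` is at least `l ^ q * μ A`. -/
lemma rpow_mul_measure_le_setIntegral_gradient {W : E → ℝ} {R : NNReal} (hW : LipschitzWith R W)
    {q : ℝ} (hq : 1 < q) {A X : Set E} (hA : MeasurableSet A)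
    (hXb : Bornology.IsBounded X) {e : E} (he : ‖e‖ = 1) {ρ l : ℝ} (hρ : 0 < ρ) (hl : 0 < l)
    (hAX : ∀ x ∈ A, ∀ s ∈ Icc 0 ρ, x + s • e ∈ X)
    (hdrop : ∀ x ∈ A, W (x + ρ • e) + 2 * l * ρ ≤ W x) :
    l ^ q * μ.real A ≤ ∫ x in X, ‖gradient W x‖ ^ q ∂μ := by
  have hAb : Bornology.IsBounded A := hXb.subset fun x hx => by
    simpa using hAX x hx 0 ⟨le_rfl, hρ.le⟩
  have : IsFiniteMeasure (μ.restrict A) := ⟨by simpa using hAb.measure_lt_top⟩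
  have hWc := hW.continuous
  have hint : ∀ s : ℝ, IntegrableOn (fun x => W (x + s • e)) A μ := fun s =>
    (Continuous.continuousOn (by fun_prop)).integrableOn_compact hAb.isCompact_closure
      |>.mono_set subset_closure
  have hmeas : ∀ s : ℝ, Measurable fun x => gradient W (x + s • e) := fun s =>
    (measurable_gradient W).comp (by fun_prop)
  have hderiv : ∀ s : ℝ, Integrable (fun x => ⟪gradient W (x + s • e), e⟫) (μ.restrict A) ∧
      HasDerivAt (fun s : ℝ => ∫ x in A, W (x + s • e) ∂μ)
        (∫ x in A, ⟪gradient W (x + s • e), e⟫ ∂μ) s := by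
    intro s
    refine hasDerivAt_integral_of_dominated_loc_of_lip (bound := fun _ => (R : ℝ)) univ_mem
      (Eventually.of_forall fun t => (hint t).aestronglyMeasurable) (hint s)
      ((hmeas s).inner_const).aestronglyMeasurable ?_ (integrable_const _) ?_
    · refine Eventually.of_forall fun x => LipschitzOnWith.of_dist_le_mul fun a _ b _ => ?_
      refine (hW.dist_le_mul _ _).trans ?_
      simp [dist_eq_norm, ← sub_smul, norm_smul, he]
    · have hae : ∀ᵐ x ∂μ, DifferentiableAt ℝ W (x + s • e) :=
        (measurePreserving_add_right μ (s • e)).quasiMeasurePreserving.ae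
          (hW.ae_differentiableAt (μ := μ))
      filter_upwards [ae_restrict_of_ae hae] with x hx
      rw [inner_gradient_left]
      have h2 : HasDerivAt (fun t : ℝ => x + t • e) e s := by
        simpa using ((hasDerivAt_id s).smul_const e).const_add x
      exact hx.hasFDerivAt.comp_hasDerivAt s h2
  obtain ⟨s, hs, hslope⟩ := exists_hasDerivAt_eq_slope _ _ hρ
    (fun s _ => (hderiv s).2.continuousAt.continuousWithinAt) fun s _ => (hderiv s).2
  have hq0 : 0 ≤ q := by linarith
  have hfint := integrableOn_norm_gradient_rpow μ hW hq0 hXb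
  have hshift : Integrable (fun x => ‖gradient W (x + s • e)‖ ^ q) (μ.restrict A) := by
    refine Integrable.of_bound ((hmeas s).norm.pow_const q).aestronglyMeasurable ((R : ℝ) ^ q)
      (Eventually.of_forall fun x => ?_)
    rw [Real.norm_of_nonneg (by positivity)]
    gcongr
    exact norm_gradient_le_of_lipschitz hW _
  have htrans : ∫ x in A, ‖gradient W (x + s • e)‖ ^ q ∂μ ≤ ∫ x in X, ‖gradient W x‖ ^ q ∂μ := by
    have himg : A = (fun x => x + s • e) ⁻¹' ((fun x => x + s • e) '' A) :=
      (preimage_image_eq A (add_left_injective _)).symm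
    have hemb : MeasurableEmbedding (fun x : E => x + s • e) :=
      (Homeomorph.addRight (s • e)).measurableEmbedding
    have := (measurePreserving_add_right μ (s • e)).setIntegral_preimage_emb hemb
      (fun x => ‖gradient W x‖ ^ q) ((fun x => x + s • e) '' A)
    rw [← himg] at this
    rw [this]
    refine setIntegral_mono_set hfint (Eventually.of_forall fun x => by positivity) ?_
    refine LE.le.eventuallyLE ?_
    rintro _ ⟨x, hx, rfl⟩
    exact hAX x hx s ⟨hs.1.le, hs.2.le⟩
  have hΦ : (∫ x in A, W (x + ρ • e) ∂μ) + 2 * l * ρ * μ.real A ≤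
      ∫ x in A, W (x + (0 : ℝ) • e) ∂μ := by
    have hc : ∫ _ in A, 2 * l * ρ ∂μ = 2 * l * ρ * μ.real A := by
      rw [setIntegral_const, smul_eq_mul, mul_comm]
    rw [← hc, ← integral_add (hint ρ) (integrable_const _)]
    refine setIntegral_mono_on ((hint ρ).add (integrable_const _)) (hint 0) hA fun x hx => ?_
    simpa using hdrop x hx
  have hpt : ∀ a : ℝ, 0 ≤ a → l ^ (q - 1) * a ≤ l ^ q + a ^ q := by
    intro a ha
    have hlq : l ^ q = l ^ (q - 1) * l := by
      rw [← Real.rpow_add_one hl.ne']; simp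
    rcases le_total a l with h | h
    · have : l ^ (q - 1) * a ≤ l ^ q := by rw [hlq]; gcongr
      have := Real.rpow_nonneg ha q
      linarith
    · have ha' : 0 < a := hl.trans_le h
      have haq : a ^ q = a ^ (q - 1) * a := by
        rw [← Real.rpow_add_one ha'.ne']; simp
      have : l ^ (q - 1) * a ≤ a ^ q := by
        rw [haq]; gcongr
      have := Real.rpow_nonneg hl.le q
      linarith
  have hlow : l ^ (q - 1) * -(∫ x in A, ⟪gradient W (x + s • e), e⟫ ∂μ) ≤
      l ^ q * μ.real A + ∫ x in A, ‖gradient W (x + s • e)‖ ^ q ∂μ := by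
    have hc : ∫ _ in A, l ^ q ∂μ = l ^ q * μ.real A := by
      rw [setIntegral_const, smul_eq_mul, mul_comm]
    rw [← hc, ← integral_add (integrable_const _) hshift, ← integral_neg, ← integral_const_mul]
    refine integral_mono ((hderiv s).1.neg.const_mul _) ((integrable_const _).add hshift)
      fun x => ?_
    refine le_trans ?_ (hpt ‖gradient W (x + s • e)‖ (norm_nonneg _))
    have h1 : -⟪gradient W (x + s • e), e⟫ ≤ ‖gradient W (x + s • e)‖ := by
      have := abs_real_inner_le_norm (gradient W (x + s • e)) e
      rw [he, mul_one] at this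
      exact (neg_le_abs _).trans this
    show l ^ (q - 1) * -⟪gradient W (x + s • e), e⟫ ≤ _
    gcongr
  have hsl : 2 * l * μ.real A ≤ -(∫ x in A, ⟪gradient W (x + s • e), e⟫ ∂μ) := by
    rw [hslope, ← neg_div, le_div_iff₀ (by linarith)]
    linarith
  have hlq : l ^ q = l ^ (q - 1) * l := by
    rw [← Real.rpow_add_one hl.ne']; simp
  have h3 : l ^ (q - 1) * (2 * l * μ.real A) ≤
      l ^ (q - 1) * -(∫ x in A, ⟪gradient W (x + s • e), e⟫ ∂μ) := by gcongr
  have h4 : l ^ (q - 1) * (2 * l * μ.real A) = 2 * (l ^ q * μ.real A) := by rw [hlq]; ring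
  linarith

end GradientBounds

section Sections

variable {n : ℕ} {X Y : Set (EuclideanSpace ℝ (Fin n))} {u : EuclideanSpace ℝ (Fin n) → ℝ}

lemma gradient_sub_of_differentiableAt {E : Type*} [NormedAddCommGroup E] [InnerProductSpace ℝ E]
    [CompleteSpace E] {f g : E → ℝ} {x : E} (hf : DifferentiableAt ℝ f x)
    (hg : DifferentiableAt ℝ g x) :
    gradient (fun y => f y - g y) x = gradient f x - gradient g x := by
  simp only [gradient]
  rw [fderiv_fun_sub hf hg, map_sub]

lemma hasGradientAt_inner_add_const {E : Type*} [NormedAddCommGroup E] [InnerProductSpace ℝ E]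
    [CompleteSpace E] (p : E) (b : ℝ) (x : E) : HasGradientAt (fun y => ⟪p, y⟫ + b) p x := by
  rw [hasGradientAt_iff_hasFDerivAt]
  exact ((InnerProductSpace.toDual ℝ E p).hasFDerivAt).add_const b

lemma lipschitzWith_inner_add_const {E : Type*} [NormedAddCommGroup E] [InnerProductSpace ℝ E]
    {p : E} {R : NNReal} (hp : ‖p‖ ≤ R) (b : ℝ) : LipschitzWith R (fun y => ⟪p, y⟫ + b) := by
  refine LipschitzWith.of_le_add_mul R fun x y => ?_
  have h := real_inner_le_norm p (x - y)
  rw [inner_sub_right] at h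
  have h2 : ‖p‖ * ‖x - y‖ ≤ R * ‖x - y‖ := by gcongr
  rw [dist_eq_norm]
  linarith

/-- The gradient of the excess `max u ℓ - u` of an affine function `ℓ` over `u`. -/
lemma gradient_excess {p : EuclideanSpace ℝ (Fin n)} {b : ℝ} {x : EuclideanSpace ℝ (Fin n)}
    (hd : DifferentiableAt ℝ u x)
    (hd' : DifferentiableAt ℝ (fun y => max (u y) (⟪p, y⟫ + b)) x) :
    (u x < ⟪p, x⟫ + b → gradient (fun y => max (u y) (⟪p, y⟫ + b)) x = p) ∧
    (⟪p, x⟫ + b ≤ u x → gradient (fun y => max (u y) (⟪p, y⟫ + b)) x = gradient u x) := by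
  constructor
  · intro hlt
    have hev : (fun y => max (u y) (⟪p, y⟫ + b)) =ᶠ[𝓝 x] fun y => ⟪p, y⟫ + b := by
      have hc : ContinuousAt (fun y => ⟪p, y⟫ + b) x := by fun_prop
      filter_upwards [hd.continuousAt.eventually_lt hc hlt] with y hy
      exact max_eq_right hy.le
    rw [hev.gradient_eq]
    exact (hasGradientAt_inner_add_const p b x).gradient
  · intro hle
    have hmin : IsLocalMin (fun y => max (u y) (⟪p, y⟫ + b) - u y) x := by
      refine Eventually.of_forall fun y => ?_
      simp only [max_eq_left hle, sub_self, sub_nonneg]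
      exact le_max_left _ _
    have h0 := hmin.fderiv_eq_zero
    have h1 := gradient_sub_of_differentiableAt hd' hd
    rw [← sub_eq_zero, ← h1, gradient, h0, map_zero]

/-- The strong convexity of `F1` turns minimality of `u` into an energy estimate for the excess of
an affine function over `u`. -/
lemma energy_excess_le {a₀ : ℝ} {y₀ : EuclideanSpace ℝ (Fin n)} (hXo : IsOpen X)
    (hXb : Bornology.IsBounded X) (hYc : Convex ℝ Y)
    {F1 : EuclideanSpace ℝ (Fin n) → EuclideanSpace ℝ (Fin n) → ℝ}
    {F0 : EuclideanSpace ℝ (Fin n) → ℝ → ℝ} {q δ : ℝ} (hq : 1 < q)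
    (H1 : ∀ x ∈ X, ∀ p₁ ∈ closure Y, ∀ p₂ ∈ closure Y,
      ⟪gradient (F1 x) p₂, p₁ - p₂⟫ + δ * ‖p₁ - p₂‖ ^ q ≤ F1 x p₁ - F1 x p₂)
    (hu : admissible X Y a₀ y₀ u)
    (hmin : ∀ v, admissible X Y a₀ y₀ v → funcL X F1 F0 u ≤ funcL X F1 F0 v)
    {R : NNReal} (huR : LipschitzWith R u) (hR : ∀ y ∈ closure Y, ‖y‖ ≤ R)
    (hint : ∀ v, admissible X Y a₀ y₀ v → LipschitzWith R v →
      IntegrableOn (fun x => F1 x (gradient v x) + F0 x (v x)) X)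
    {p : EuclideanSpace ℝ (Fin n)} (hp : p ∈ closure Y)
    (hV : Continuous fun x => gradient (F1 x) p) (b : ℝ) {H C₀ : ℝ}
    (hF0 : ∀ x ∈ X, ∀ a, 0 ≤ a → a ≤ H → F0 x (u x + a) - F0 x (u x) ≤ C₀ * a)
    (hH : ∀ x ∈ X, max (u x) (⟪p, x⟫ + b) - u x ≤ H) :
    δ * ∫ x in X, ‖gradient (fun y => max (u y) (⟪p, y⟫ + b) - u y) x‖ ^ q ≤
      (∫ x in X, ⟪gradient (fun y => max (u y) (⟪p, y⟫ + b) - u y) x, gradient (F1 x) p⟫) +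
        C₀ * ∫ x in X, (max (u x) (⟪p, x⟫ + b) - u x) := by
  set v : EuclideanSpace ℝ (Fin n) → ℝ := fun y => max (u y) (⟪p, y⟫ + b) with hv_def
  have hv : admissible X Y a₀ y₀ v := admissible_max hXo hYc hu hp b
  have hvR : LipschitzWith R v := by
    have := huR.max (lipschitzWith_inner_add_const (hR p hp) b)
    rwa [max_self] at this
  set W : EuclideanSpace ℝ (Fin n) → ℝ := fun y => v y - u y with hW_def
  have hWR : LipschitzWith (R + R) W := hvR.sub huR
  have hfin : IsFiniteMeasure ((volume : Measure (EuclideanSpace ℝ (Fin n))).restrict X) :=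
    ⟨by simpa using hXb.measure_lt_top⟩
  have hcpt : IsCompact (closure X) := hXb.isCompact_closure
  have hi1 : IntegrableOn (fun x => ⟪gradient W x, gradient (F1 x) p⟫) X := by
    obtain ⟨M, hM⟩ := hcpt.exists_bound_of_continuousOn hV.continuousOn
    refine Integrable.of_bound
      ((measurable_gradient W).inner hV.measurable).aestronglyMeasurable ((R + R : NNReal) * M) ?_
    filter_upwards [ae_restrict_mem hXo.measurableSet] with x hx
    refine (norm_inner_le_norm _ _).trans ?_
    gcongr
    · exact norm_gradient_le_of_lipschitz hWR x
    · exact hM x (subset_closure hx)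
  have hi2 : IntegrableOn (fun x => ‖gradient W x‖ ^ q) X :=
    integrableOn_norm_gradient_rpow volume hWR (by linarith) hXb
  have hi3 : IntegrableOn W X :=
    (hWR.continuous.continuousOn.integrableOn_compact hcpt).mono_set subset_closure
  have hiu := hint u hu huR
  have hiv := hint v hv hvR
  have h0 : 0 ≤ ∫ x in X, ((F1 x (gradient v x) + F0 x (v x)) -
      (F1 x (gradient u x) + F0 x (u x))) := by
    rw [integral_sub hiv hiu]
    exact sub_nonneg.2 (hmin v hv)
  have hle : ∫ x in X, ((F1 x (gradient v x) + F0 x (v x)) -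
      (F1 x (gradient u x) + F0 x (u x))) ≤
      ∫ x in X, (⟪gradient W x, gradient (F1 x) p⟫ + C₀ * W x - δ * ‖gradient W x‖ ^ q) := by
    refine integral_mono_ae (hiv.sub hiu) ((hi1.add (hi3.const_mul C₀)).sub (hi2.const_mul δ)) ?_
    filter_upwards [ae_restrict_mem hXo.measurableSet,
      ae_restrict_of_ae huR.ae_differentiableAt, ae_restrict_of_ae hvR.ae_differentiableAt]
      with x hx hdu hdv
    have hWx : gradient W x = gradient v x - gradient u x :=
      gradient_sub_of_differentiableAt hdv hdu
    have hcases := gradient_excess hdu hdv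
    rcases lt_or_ge (u x) (⟪p, x⟫ + b) with hlt | hge
    · have hgv : gradient v x = p := hcases.1 hlt
      have hgu : gradient u x ∈ closure Y := hu.2.1 x hx (gradient_mem_subgrad hu.1 hx hdu)
      have h1 := H1 x hx _ hgu p hp
      have h2 := hF0 x hx (W x) (sub_nonneg.2 (le_max_left _ _)) (hH x hx)
      rw [show u x + W x = v x by simp [W]] at h2
      rw [hWx, hgv, ← norm_neg, neg_sub, real_inner_comm]
      rw [← neg_sub p, inner_neg_right, norm_neg, ← norm_neg, neg_sub] at h1
      linarith
    · have hgv : gradient v x = gradient u x := hcases.2 hge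
      have hvx : v x = u x := max_eq_left hge
      have hWx0 : W x = 0 := by simp [W, hvx]
      rw [hWx, hgv, hvx, hWx0]
      simp [Real.zero_rpow (by linarith : q ≠ 0)]
  have hsplit : ∫ x in X, (⟪gradient W x, gradient (F1 x) p⟫ + C₀ * W x -
      δ * ‖gradient W x‖ ^ q) = (∫ x in X, ⟪gradient W x, gradient (F1 x) p⟫) +
        C₀ * (∫ x in X, W x) - δ * ∫ x in X, ‖gradient W x‖ ^ q := by
    have hi4 : IntegrableOn (fun x => ⟪gradient W x, gradient (F1 x) p⟫ + C₀ * W x) X :=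
      hi1.add (hi3.const_mul C₀)
    rw [integral_sub hi4 (hi2.const_mul δ), integral_add hi1 (hi3.const_mul C₀),
      integral_const_mul, integral_const_mul]
  rw [hsplit] at hle
  have := h0.trans hle
  linarith

end Sections

section Height

variable {n : ℕ} {X Y : Set (EuclideanSpace ℝ (Fin n))} {u : EuclideanSpace ℝ (Fin n) → ℝ}

/-- At a maximum point over a ball of the excess of a convex function over one of its supporting
affine functions, the slope of the function exceeds that of the support in a fixed direction. -/
lemma exists_tilting_direction (hXo : IsOpen X) (hu : ConvexOn ℝ X u)
    {x₀ : EuclideanSpace ℝ (Fin n)} (p : EuclideanSpace ℝ (Fin n)) {r : ℝ} (hr : 0 < r)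
    (hball : Metric.closedBall x₀ r ⊆ X) :
    ∃ x₁ ∈ Metric.closedBall x₀ r,
      (∀ z ∈ Metric.closedBall x₀ r,
        u z - u x₀ - ⟪p, z - x₀⟫ ≤ u x₁ - u x₀ - ⟪p, x₁ - x₀⟫) ∧
      0 ≤ u x₁ - u x₀ - ⟪p, x₁ - x₀⟫ ∧
      (0 < u x₁ - u x₀ - ⟪p, x₁ - x₀⟫ →
        ∃ (e : EuclideanSpace ℝ (Fin n)) (s : ℝ), ‖e‖ = 1 ∧
          u x₁ - u x₀ - ⟪p, x₁ - x₀⟫ ≤ s * r ∧ p + s • e ∈ subgrad X u x₁ ∧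
          ∀ z ∈ X, u x₁ - u x₀ - ⟪p, x₁ - x₀⟫ + s * (⟪e, z - x₀⟫ - r) ≤
            u z - u x₀ - ⟪p, z - x₀⟫) := by
  have hx₀X : x₀ ∈ X := hball (Metric.mem_closedBall_self hr.le)
  have hcont : ContinuousOn (fun z => u z - u x₀ - ⟪p, z - x₀⟫) (Metric.closedBall x₀ r) := by
    have := (hu.continuousOn hXo).mono hball
    fun_prop
  obtain ⟨x₁, hx₁, hmax⟩ := (isCompact_closedBall x₀ r).exists_isMaxOn
    ⟨x₀, Metric.mem_closedBall_self hr.le⟩ hcont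
  have hmax : ∀ z ∈ Metric.closedBall x₀ r,
      u z - u x₀ - ⟪p, z - x₀⟫ ≤ u x₁ - u x₀ - ⟪p, x₁ - x₀⟫ := fun z hz => hmax hz
  refine ⟨x₁, hx₁, hmax, ?_, fun hpos => ?_⟩
  · simpa using hmax x₀ (Metric.mem_closedBall_self hr.le)
  obtain ⟨P, hP⟩ := subgrad_nonempty hXo hu (hball hx₁)
  set m := P - p with hm
  set h := u x₁ - u x₀ - ⟪p, x₁ - x₀⟫ with hh
  have hlow : ∀ z ∈ X, h + ⟪m, z - x₁⟫ ≤ u z - u x₀ - ⟪p, z - x₀⟫ := by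
    intro z hz
    have h1 := hP z hz
    have h2 : z - x₀ = (z - x₁) + (x₁ - x₀) := by abel
    rw [hm, inner_sub_left, h2, inner_add_right]
    linarith
  have hx₀low := hlow x₀ hx₀X
  simp only [sub_self, inner_zero_right] at hx₀low
  have hm0 : m ≠ 0 := by
    intro h0
    rw [h0, inner_zero_left] at hx₀low
    linarith
  have hmpos : 0 < ‖m‖ := norm_pos_iff.2 hm0
  set e := ‖m‖⁻¹ • m
  have he : ‖e‖ = 1 := by simp [e, norm_smul, hmpos.ne']
  have hme : m = ‖m‖ • e := by simp [e, smul_smul, hmpos.ne']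
  have hmi : ∀ z, ⟪m, z⟫ = ‖m‖ * ⟪e, z⟫ := fun z => by
    conv_lhs => rw [hme, real_inner_smul_left]
  have hee : ⟪e, e⟫ = (1 : ℝ) := by rw [real_inner_self_eq_norm_sq, he]; norm_num
  have ht1 : ⟪e, x₁ - x₀⟫ ≤ r := by
    refine (real_inner_le_norm _ _).trans ?_
    rw [he, one_mul]
    exact mem_closedBall_iff_norm.1 hx₁
  have hre : x₀ + r • e ∈ Metric.closedBall x₀ r := by
    simp [norm_smul, he, abs_of_pos hr]
  have ht2 : r ≤ ⟪e, x₁ - x₀⟫ := by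
    have h1 := (hlow _ (hball hre)).trans (hmax _ hre)
    have h2 : x₀ + r • e - x₁ = r • e - (x₁ - x₀) := by abel
    rw [hmi, h2, inner_sub_right, inner_smul_right, hee] at h1
    nlinarith
  have ht : ⟪e, x₁ - x₀⟫ = r := le_antisymm ht1 ht2
  refine ⟨e, ‖m‖, he, ?_, ?_, fun z hz => ?_⟩
  · rw [hmi, ← neg_sub x₁ x₀, inner_neg_right, ht] at hx₀low
    linarith
  · rw [← hme, hm, add_sub_cancel]
    exact hP
  · have h1 := hlow z hz
    have h2 : z - x₁ = (z - x₀) - (x₁ - x₀) := by abel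
    rwa [hmi, h2, inner_sub_right, ht] at h1

/-- The excess of a convex function over a supporting affine function on a ball of radius `r` has
height controlled by the energy inequality. -/
lemma section_height_le (hXo : IsOpen X) (hXb : Bornology.IsBounded X) (hYc : Convex ℝ Y)
    (hu : ConvexOn ℝ X u) (hs : ∀ x ∈ X, subgrad X u x ⊆ closure Y) {R : NNReal}
    (huR : LipschitzWith R u) (hR : ∀ y ∈ closure Y, ‖y‖ ≤ R)
    {V : EuclideanSpace ℝ (Fin n) → EuclideanSpace ℝ (Fin n) → EuclideanSpace ℝ (Fin n)}
    (hV : ∀ p ∈ closure Y, Continuous (V p)) {L : NNReal}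
    (hVL : ∀ p ∈ closure Y, LipschitzOnWith L (V p) X) {M : ℝ} (hM0 : 0 ≤ M)
    (hVM : ∀ p ∈ closure Y, ∀ x ∈ X, ‖V p x‖ ≤ M) {q δ C₀ : ℝ} (hq : 1 < q) (hδ : 0 < δ)
    (hC₀ : 0 ≤ C₀)
    (henergy : ∀ p ∈ closure Y, ∀ b : ℝ,
      (∀ x ∈ X, max (u x) (⟪p, x⟫ + b) - u x ≤ 2 * R) →
      δ * ∫ x in X, ‖gradient (fun y => max (u y) (⟪p, y⟫ + b) - u y) x‖ ^ q ≤
        (∫ x in X, ⟪gradient (fun y => max (u y) (⟪p, y⟫ + b) - u y) x, V p x⟫) +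
          C₀ * ∫ x in X, (max (u x) (⟪p, x⟫ + b) - u x))
    {d : ℝ} {x₀ p : EuclideanSpace ℝ (Fin n)} (hd : 0 < d) (hball : Metric.ball x₀ d ⊆ X)
    (hp : p ∈ subgrad X u x₀) {r : ℝ} (hr : 0 < r) (hr1 : r ≤ 1) (hrd : 4 * r < d) :
    ∃ h : ℝ, 0 ≤ h ∧ (∀ z ∈ Metric.closedBall x₀ r, u z - u x₀ - ⟪p, z - x₀⟫ ≤ h) ∧
      (0 < h → δ * (h / (16 * r)) ^ q ≤
        2 ^ n * ((M + 1) / d + n * ((M + 1) / d + L) + C₀) * h) := by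
  have hx₀X : x₀ ∈ X := hball (Metric.mem_ball_self hd)
  have hcb : Metric.closedBall x₀ r ⊆ X :=
    (Metric.closedBall_subset_ball (by linarith)).trans hball
  obtain ⟨x₁, hx₁, hmax, hnn, hdir⟩ := exists_tilting_direction hXo hu p hr hcb
  set h := u x₁ - u x₀ - ⟪p, x₁ - x₀⟫ with hh
  refine ⟨h, hnn, hmax, fun hpos => ?_⟩
  obtain ⟨e, s, he, hsr, hPs, hlow⟩ := hdir hpos
  have hpY : p ∈ closure Y := hs x₀ hx₀X hp
  set κ : ℝ := (M + 1) / d with hκ_def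
  have hκ : 0 < κ := by positivity
  have hhR : h ≤ 2 * R := by
    have h1 := huR.dist_le_mul x₁ x₀
    have h2 := abs_real_inner_le_norm p (x₁ - x₀)
    have h3 : ‖x₁ - x₀‖ ≤ r := mem_closedBall_iff_norm.1 hx₁
    rw [Real.dist_eq, dist_eq_norm] at h1
    have h4 : (R : ℝ) * ‖x₁ - x₀‖ ≤ R * 1 := by gcongr; linarith
    have h5 : ‖p‖ * ‖x₁ - x₀‖ ≤ R * 1 := by
      gcongr
      · exact hR p hpY
      · linarith
    have := le_abs_self (u x₁ - u x₀)
    have := neg_abs_le ⟪p, x₁ - x₀⟫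
    linarith
  set k : ℝ := h / (2 * r) with hk_def
  have hk : 0 < k := by positivity
  have hkr : k * r = h / 2 := by rw [hk_def]; field_simp
  have hks : 2 * k ≤ s := by
    rw [hk_def, ← mul_div_assoc, mul_div_mul_left _ _ (two_ne_zero), div_le_iff₀ hr]
    exact hsr
  have hspos : 0 < s := by linarith
  set p' := p + k • e with hp'_def
  have hp' : p' ∈ closure Y := by
    have h1 := hs x₁ (hcb hx₁) hPs
    have h2 : k / s ≤ 1 := by rw [div_le_one hspos]; linarith
    have := hYc.closure hpY h1 (sub_nonneg.2 h2) (by positivity : (0 : ℝ) ≤ k / s) (by ring)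
    convert this using 1
    rw [hp'_def, smul_add, smul_smul, div_mul_cancel₀ _ hspos.ne']
    module
  set b : ℝ := u x₀ - ⟪p, x₀⟫ - k * ⟪e, x₀⟫ + k * r with hb_def
  have hdiff : ∀ x, ⟪p', x⟫ + b - u x =
      k * (⟪e, x - x₀⟫ + r) - (u x - u x₀ - ⟪p, x - x₀⟫) := by
    intro x
    rw [hp'_def, hb_def, inner_add_left, real_inner_smul_left, inner_sub_right, inner_sub_right]
    ring
  have hf0 : ∀ x ∈ X, 0 ≤ u x - u x₀ - ⟪p, x - x₀⟫ := fun x hx => by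
    have := hp x hx
    linarith
  set S : Set (EuclideanSpace ℝ (Fin n)) := {x | x ∈ X ∧ u x < ⟪p', x⟫ + b} with hS_def
  have hSo : IsOpen S := hXo.inter (isOpen_lt huR.continuous (by fun_prop))
  have hSX : S ⊆ X := fun x hx => hx.1
  have hSslab : ∀ x ∈ S, -r < ⟪e, x - x₀⟫ ∧ ⟪e, x - x₀⟫ < r := by
    rintro x ⟨hx, hlt⟩
    have h1 := hdiff x
    have h2 := hf0 x hx
    have h3 : 0 < k * (⟪e, x - x₀⟫ + r) := by linarith
    have h4 : 0 < ⟪e, x - x₀⟫ + r := pos_of_mul_pos_right h3 hk.le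
    refine ⟨by linarith, ?_⟩
    by_contra! hge
    have h5 := hlow x hx
    have h6 : 2 * k * (⟪e, x - x₀⟫ - r) ≤ s * (⟪e, x - x₀⟫ - r) :=
      mul_le_mul_of_nonneg_right hks (by linarith)
    have h7 : 0 ≤ k * (⟪e, x - x₀⟫ - r) := mul_nonneg hk.le (by linarith)
    nlinarith
  set W : EuclideanSpace ℝ (Fin n) → ℝ := fun y => max (u y) (⟪p', y⟫ + b) - u y with hW_def
  have hvR : LipschitzWith R (fun y => max (u y) (⟪p', y⟫ + b)) := by
    have := huR.max (lipschitzWith_inner_add_const (hR p' hp') b)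
    rwa [max_self] at this
  have hWR : LipschitzWith (R + R) W := hvR.sub huR
  have hW0 : ∀ x, 0 ≤ W x := fun x => sub_nonneg.2 (le_max_left _ _)
  have hWS : ∀ x ∈ X, x ∉ S → W x = 0 := fun x hx hxS => by
    have : ⟪p', x⟫ + b ≤ u x := not_lt.1 fun hlt => hxS ⟨hx, hlt⟩
    simp [W, max_eq_left this]
  have hWin : ∀ x ∈ S, W x = ⟪p', x⟫ + b - u x := fun x hx => by
    simp [W, max_eq_right hx.2.le]
  have hWh : ∀ x ∈ S, W x ≤ h := by
    intro x hx
    rw [hWin x hx, hdiff]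
    have h1 := hf0 x hx.1
    have h2 : k * (⟪e, x - x₀⟫ + r) ≤ k * (r + r) := by
      gcongr
      exact (hSslab x hx).2.le
    linarith
  have hWX : ∀ x ∈ X, W x ≤ S.indicator (fun _ => h) x := by
    intro x hx
    by_cases hxS : x ∈ S
    · rw [indicator_of_mem hxS]; exact hWh x hxS
    · rw [indicator_of_notMem hxS, hWS x hx hxS]
  have hx₀S : x₀ ∈ S := by
    refine ⟨hx₀X, sub_pos.1 ?_⟩
    rw [hdiff]
    simp only [sub_self, inner_zero_right, zero_add, sub_zero, hkr]
    linarith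
  have hen := henergy p' hp' b fun x hx => by
    refine (hWX x hx).trans (le_trans ?_ hhR)
    exact indicator_le_self' (fun _ _ => hpos.le) x
  have hfin : IsFiniteMeasure ((volume : Measure (EuclideanSpace ℝ (Fin n))).restrict X) :=
    ⟨by simpa using hXb.measure_lt_top⟩
  have hcpt : IsCompact (closure X) := hXb.isCompact_closure
  have hSfin : volume S ≠ ⊤ := (hXb.subset hSX).measure_lt_top.ne
  have hSpos : 0 < volume.real S :=
    ENNReal.toReal_pos (hSo.measure_pos volume ⟨x₀, hx₀S⟩).ne' hSfin
  have hindint : ∫ x in X, S.indicator (fun _ => h) x = h * volume.real S := by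
    rw [setIntegral_indicator hSo.measurableSet, inter_eq_self_of_subset_right hSX,
      setIntegral_const, smul_eq_mul, mul_comm]
  have hindi : IntegrableOn (S.indicator fun _ => h) X :=
    (integrable_const h).indicator hSo.measurableSet
  have hWi : IntegrableOn W X :=
    (hWR.continuous.continuousOn.integrableOn_compact hcpt).mono_set subset_closure
  have hWint : ∫ x in X, W x ≤ h * volume.real S := by
    rw [← hindint]
    exact setIntegral_mono_on hWi hindi hXo.measurableSet hWX
  have hinner : ∀ Q : EuclideanSpace ℝ (Fin n) → EuclideanSpace ℝ (Fin n), Continuous Q →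
      IntegrableOn (fun x => ⟪gradient W x, Q x⟫) X := by
    intro Q hQ
    obtain ⟨B, hB⟩ := hcpt.exists_bound_of_continuousOn hQ.continuousOn
    refine Integrable.of_bound
      ((measurable_gradient W).inner hQ.measurable).aestronglyMeasurable ((R + R : NNReal) * B) ?_
    filter_upwards [ae_restrict_mem hXo.measurableSet] with x hx
    refine (norm_inner_le_norm _ _).trans ?_
    gcongr
    · exact norm_gradient_le_of_lipschitz hWR x
    · exact hB x (subset_closure hx)
  have hradial : ∫ x in X, ⟪gradient W x, x - x₀⟫ ≤ h * volume.real S := by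
    rw [← hindint]
    refine integral_mono_ae (hinner _ (by fun_prop)) hindi ?_
    filter_upwards [ae_restrict_mem hXo.measurableSet,
      ae_restrict_of_ae huR.ae_differentiableAt, ae_restrict_of_ae hvR.ae_differentiableAt]
      with x hx hdu hdv
    have hWx : gradient W x = gradient (fun y => max (u y) (⟪p', y⟫ + b)) x - gradient u x :=
      gradient_sub_of_differentiableAt hdv hdu
    by_cases hxS : x ∈ S
    · rw [indicator_of_mem hxS, hWx, (gradient_excess hdu hdv).1 hxS.2, inner_sub_left]
      have h1 := gradient_mem_subgrad hu hx hdu x₀ hx₀X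
      have h2 := hWh x hxS
      have h3 := hx₀S.2
      rw [hWin x hxS] at h2
      rw [← neg_sub x x₀, inner_neg_right] at h1
      rw [inner_sub_right p']
      linarith
    · rw [indicator_of_notMem hxS, hWx, (gradient_excess hdu hdv).2
        (not_lt.1 fun hlt => hxS ⟨hx, hlt⟩)]
      simp
  have hflux := setIntegral_inner_gradient_le volume hXo hXb hu.1 hball (hV p' hp') (hVL p' hp') hκ
    (fun x hx => by
      rw [hκ_def, div_mul_cancel₀ _ hd.ne']
      linarith [hVM p' hp' x hx]) hWR hW0
  have hsplit : ∫ x in X, ⟪gradient W x, V p' x - κ • (x - x₀)⟫ =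
      (∫ x in X, ⟪gradient W x, V p' x⟫) - κ * ∫ x in X, ⟪gradient W x, x - x₀⟫ := by
    rw [← integral_const_mul, ← integral_sub (hinner _ (hV p' hp'))
      ((hinner _ (by fun_prop)).const_mul κ)]
    simp only [inner_sub_right, inner_smul_right]
  rw [hsplit, finrank_euclideanSpace_fin] at hflux
  have hupper : δ * ∫ x in X, ‖gradient W x‖ ^ q ≤
      (κ + n * (κ + L) + C₀) * (h * volume.real S) := by
    have h1 : κ * ∫ x in X, ⟪gradient W x, x - x₀⟫ ≤ κ * (h * volume.real S) := by gcongr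
    have h2 : n * (κ + L) * ∫ x in X, W x ≤ n * (κ + L) * (h * volume.real S) := by gcongr
    have h3 : C₀ * ∫ x in X, W x ≤ C₀ * (h * volume.real S) := by gcongr
    have hen' : δ * ∫ x in X, ‖gradient W x‖ ^ q ≤
      (∫ x in X, ⟪gradient W x, V p' x⟫) + C₀ * ∫ x in X, W x := hen
    linarith
  set A : Set (EuclideanSpace ℝ (Fin n)) := (fun x => x₀ + (2 : ℝ) • (x - x₀)) ⁻¹' S
  have hAo : IsOpen A := hSo.preimage (by fun_prop)
  have hAvol : 2 ^ n * volume.real A = volume.real S := by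
    have himg : A = AffineMap.homothety x₀ (1 / 2 : ℝ) '' S := by
      ext x
      constructor
      · intro hx
        refine ⟨_, hx, ?_⟩
        simp [AffineMap.homothety_apply, smul_smul]
      · rintro ⟨z, hz, rfl⟩
        simpa [A, AffineMap.homothety_apply, smul_smul] using hz
    rw [himg, measureReal_def, Measure.addHaar_image_homothety, finrank_euclideanSpace_fin,
      ENNReal.toReal_mul, ENNReal.toReal_ofReal (abs_nonneg _), measureReal_def,
      abs_of_pos (by positivity), ← mul_assoc, ← mul_pow]
    norm_num
  have half : (0 : ℝ) ≤ 1 / 2 := by norm_num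
  have hlower := rpow_mul_measure_le_setIntegral_gradient volume hWR hq hAo.measurableSet hXb he
    (X := X) (ρ := 2 * r) (l := h / (16 * r)) (by positivity) (by positivity)
    (by
      intro x hx σ hσ
      have hz : x₀ + (2 : ℝ) • (x - x₀) ∈ X := hSX hx
      have hy : x₀ + (2 * σ) • e ∈ X := by
        apply hball
        rw [mem_ball_iff_norm, add_sub_cancel_left, norm_smul, he, mul_one,
          Real.norm_of_nonneg (by linarith [hσ.1])]
        linarith [hσ.2]
      have := hu.1 hz hy half half (by norm_num)
      convert this using 1
      module)
    (by
      intro x hx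
      have hz : x₀ + (2 : ℝ) • (x - x₀) ∈ S := hx
      set z := x₀ + (2 : ℝ) • (x - x₀) with hz_def
      have hxm : x = (1 / 2 : ℝ) • x₀ + (1 / 2 : ℝ) • z := by rw [hz_def]; module
      have hcv := hu.2 hx₀X (hSX hz) half half (by norm_num)
      rw [← hxm] at hcv
      have hin : ⟪p', x⟫ = 1 / 2 * ⟪p', x₀⟫ + 1 / 2 * ⟪p', z⟫ := by
        rw [hxm, inner_add_right, inner_smul_right, inner_smul_right]
      have h1 : ⟪p', x₀⟫ + b - u x₀ = h / 2 := by rw [hdiff]; simp [hkr]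
      have h2 : u z < ⟪p', z⟫ + b := hz.2
      have h3 : ⟪p', x⟫ + b - u x ≤ W x := sub_le_sub_right (le_max_right _ _) _
      have h4 : 2 * (h / (16 * r)) * (2 * r) = h / 4 := by field_simp; norm_num
      have h5 : W (x + (2 * r) • e) = 0 := by
        have hnot : x + (2 * r) • e ∉ S := by
          intro hmem
          have h6 := (hSslab _ hmem).2
          have h7 := (hSslab z hz).1
          have h8 : z - x₀ = (2 : ℝ) • (x - x₀) := by rw [hz_def]; abel
          have h9 : x + (2 * r) • e - x₀ = (x - x₀) + (2 * r) • e := by abel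
          have hee : ⟪e, e⟫ = (1 : ℝ) := by rw [real_inner_self_eq_norm_sq, he]; norm_num
          rw [h8, inner_smul_right] at h7
          rw [h9, inner_add_right, inner_smul_right, hee] at h6
          linarith
        by_cases hX' : x + (2 * r) • e ∈ X
        · exact hWS _ hX' hnot
        · exfalso
          apply hX'
          have hy : x₀ + (4 * r) • e ∈ X := by
            apply hball
            rw [mem_ball_iff_norm, add_sub_cancel_left, norm_smul, he, mul_one,
              Real.norm_of_nonneg (by linarith)]
            exact hrd
          have := hu.1 (hSX hz) hy half half (by norm_num)
          convert this using 1
          rw [hz_def]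
          module
      rw [h5, h4]
      simp only [smul_eq_mul] at hcv
      linarith)
  have hfinal : δ * ((h / (16 * r)) ^ q * volume.real A) ≤
      (κ + n * (κ + L) + C₀) * (h * (2 ^ n * volume.real A)) := by
    rw [hAvol]
    exact (mul_le_mul_of_nonneg_left hlower hδ.le).trans hupper
  have hApos : 0 < volume.real A := by
    have : 0 < 2 ^ n * volume.real A := hAvol ▸ hSpos
    exact pos_of_mul_pos_right this (by positivity)
  refine le_of_mul_le_mul_right ?_ hApos
  calc δ * (h / (16 * r)) ^ q * volume.real A = δ * ((h / (16 * r)) ^ q * volume.real A) := by ring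
    _ ≤ _ := hfinal
    _ = _ := by ring

end Height

section Regularity

/-- Solving the height inequality `δ (h / 16 r) ^ q ≤ C h` for `h`. -/
lemma le_rpow_of_height_inequality {q δ C h r α : ℝ} (hq : 1 < q) (hδ : 0 < δ) (hC : 0 ≤ C)
    (hh : 0 < h) (hr : 0 < r) (hr1 : r ≤ 1) (hα : α = if 2 < q then 1 / (q - 1) else 1)
    (hle : δ * (h / (16 * r)) ^ q ≤ C * h) :
    h ≤ (C * 16 ^ q / δ) ^ (1 / (q - 1)) * r ^ (1 + α) := by
  have hq1 : 0 < q - 1 := by linarith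
  have hexp : 1 + α ≤ q / (q - 1) := by
    rw [hα]
    split_ifs with h2
    · apply le_of_eq
      field_simp
      ring
    · rw [le_div_iff₀ hq1]
      linarith
  have hpow : h ^ (q - 1) ≤ C * 16 ^ q / δ * r ^ q := by
    rw [Real.div_rpow hh.le (by positivity), Real.mul_rpow (by norm_num) hr.le] at hle
    rw [Real.rpow_sub_one hh.ne', div_le_iff₀ hh]
    have hpos : 0 < (16 : ℝ) ^ q * r ^ q := by positivity
    rw [← mul_div_assoc, div_le_iff₀ hpos] at hle
    rw [div_mul_eq_mul_div, div_mul_eq_mul_div, le_div_iff₀ hδ]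
    linarith
  calc h = (h ^ (q - 1)) ^ (1 / (q - 1)) := by
        rw [← Real.rpow_mul hh.le, mul_one_div_cancel hq1.ne', Real.rpow_one]
    _ ≤ (C * 16 ^ q / δ * r ^ q) ^ (1 / (q - 1)) := by gcongr
    _ = (C * 16 ^ q / δ) ^ (1 / (q - 1)) * r ^ (q / (q - 1)) := by
        rw [Real.mul_rpow (by positivity) (by positivity), ← Real.rpow_mul hr.le, mul_one_div]
    _ ≤ (C * 16 ^ q / δ) ^ (1 / (q - 1)) * r ^ (1 + α) :=
        mul_le_mul_of_nonneg_left (Real.rpow_le_rpow_of_exponent_ge hr hr1 hexp) (by positivity)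

variable {n : ℕ} {X Y : Set (EuclideanSpace ℝ (Fin n))} {u : EuclideanSpace ℝ (Fin n) → ℝ}

/-- A function lying between an affine support and its perturbation of higher order is
differentiable at the contact point. -/
lemma hasGradientAt_of_excess_le (hXo : IsOpen X) {x p : EuclideanSpace ℝ (Fin n)} (hx : x ∈ X)
    (hp : p ∈ subgrad X u x) {C r₀ α : ℝ} (hr₀ : 0 < r₀) (hα : 0 < α)
    (hC : ∀ z, ‖z - x‖ ≤ r₀ → u z - u x - ⟪p, z - x⟫ ≤ C * ‖z - x‖ ^ (1 + α)) :
    HasGradientAt u p x := by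
  rw [hasGradientAt_iff_isLittleO]
  have hbig : (fun z => u z - u x - ⟪p, z - x⟫) =O[𝓝 x] fun z => ‖z - x‖ ^ (1 + α) := by
    refine Asymptotics.IsBigO.of_bound C ?_
    filter_upwards [hXo.mem_nhds hx, Metric.closedBall_mem_nhds x hr₀] with z hz hzr
    have h1 := hp z hz
    rw [Real.norm_of_nonneg (by linarith), Real.norm_of_nonneg (by positivity)]
    exact hC z (mem_closedBall_iff_norm.1 hzr)
  refine hbig.trans_isLittleO ?_
  have hto : Tendsto (fun z => ‖z - x‖ ^ α) (𝓝 x) (𝓝 0) := by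
    have : Continuous fun z => ‖z - x‖ ^ α := by fun_prop (disch := exact hα.le)
    simpa [Real.zero_rpow hα.ne'] using this.tendsto x
  have h1 : (fun z => ‖z - x‖ ^ (1 + α)) = fun z => ‖z - x‖ ^ α * ‖z - x‖ := by
    funext z
    rw [add_comm, Real.rpow_add_one' (norm_nonneg _) (by linarith)]
  rw [h1]
  have := ((Asymptotics.isLittleO_one_iff ℝ).2 hto).mul_isBigO
    (Asymptotics.isBigO_refl (fun z => ‖z - x‖) (𝓝 x))
  simp only [one_mul] at this
  exact this.of_norm_right

/-- Quantitative comparison of the supporting slopes at two nearby points. -/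
lemma norm_subgrad_sub_le {x y p p' : EuclideanSpace ℝ (Fin n)} (hx : x ∈ X)
    (hp : p ∈ subgrad X u x) (hp' : p' ∈ subgrad X u y) {C r₀ α : ℝ} (hC0 : 0 ≤ C)
    (hxy : x ≠ y) (hr₀ : 2 * ‖x - y‖ ≤ r₀) (hball : Metric.closedBall y r₀ ⊆ X) (hα : 0 < α)
    (hC : ∀ z, ‖z - y‖ ≤ r₀ → u z - u y - ⟪p', z - y⟫ ≤ C * ‖z - y‖ ^ (1 + α)) :
    ‖p - p'‖ ≤ C * 2 ^ (1 + α) * ‖x - y‖ ^ α := by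
  have hρ : 0 < ‖x - y‖ := norm_pos_iff.2 (sub_ne_zero.2 hxy)
  rcases eq_or_ne (p - p') 0 with h0 | h0
  · rw [h0, norm_zero]
    positivity
  have hm : 0 < ‖p - p'‖ := norm_pos_iff.2 h0
  set w := (‖x - y‖ / ‖p - p'‖) • (p - p') with hw
  have hwn : ‖w‖ = ‖x - y‖ := by
    rw [hw, norm_smul, Real.norm_of_nonneg (by positivity), div_mul_cancel₀ _ hm.ne']
  have hwi : ⟪p, w⟫ - ⟪p', w⟫ = ‖p - p'‖ * ‖x - y‖ := by
    rw [← inner_sub_left, hw, inner_smul_right, real_inner_self_eq_norm_sq]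
    field_simp
  have hsplit : x + w - y = (x - y) + w := by abel
  have hzn : ‖x + w - y‖ ≤ 2 * ‖x - y‖ := by
    rw [hsplit]
    linarith [norm_add_le (x - y) w]
  have h1 := hC (x + w) (hzn.trans hr₀)
  have h2 := hp (x + w) (hball (mem_closedBall_iff_norm.2 (hzn.trans hr₀)))
  have h3 := hp' x hx
  have h4 : C * ‖x + w - y‖ ^ (1 + α) ≤ C * (2 * ‖x - y‖) ^ (1 + α) := by gcongr
  rw [Real.mul_rpow (by norm_num) hρ.le, add_comm 1 α, Real.rpow_add_one hρ.ne',
    add_comm α 1] at h4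
  rw [hsplit, inner_add_right, ← hsplit] at h1
  rw [add_sub_cancel_left] at h2
  refine le_of_mul_le_mul_right ?_ hρ
  linarith

lemma contDiff_gradient_of_contDiff {E : Type*} [NormedAddCommGroup E] [InnerProductSpace ℝ E]
    [CompleteSpace E] {F : E → E → ℝ} (hF : ContDiff ℝ 2 fun z : E × E => F z.1 z.2) :
    ContDiff ℝ 1 fun z : E × E => gradient (F z.1) z.2 := by
  have h1 : ContDiff ℝ 1 fun z : E × E => fderiv ℝ (F z.1) z.2 := by
    refine ContDiff.fderiv (m := 2) (f := fun z : E × E => F z.1) ?_ contDiff_snd (by norm_num)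
    exact hF.comp (by fun_prop : ContDiff ℝ 2 fun w : (E × E) × E => (w.1.1, w.2))
  exact (InnerProductSpace.toDual ℝ E).symm.contDiff.comp h1

/-- A `C¹` function is Lipschitz on bounded sets. -/
lemma ContDiff.exists_lipschitzOnWith_of_isBounded {E F : Type*} [NormedAddCommGroup E]
    [NormedSpace ℝ E] [FiniteDimensional ℝ E] [NormedAddCommGroup F] [NormedSpace ℝ F]
    {f : E → F} (hf : ContDiff ℝ 1 f) {s : Set E} (hs : Bornology.IsBounded s) :
    ∃ K : NNReal, LipschitzOnWith K f s := by
  have : ProperSpace E := FiniteDimensional.proper_real E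
  obtain ⟨K, hK⟩ := hf.locallyLipschitz.locallyLipschitzOn.exists_lipschitzOnWith_of_compact
    hs.isCompact_closure
  exact ⟨K, hK.mono subset_closure⟩

/-- Strong convexity passes to the closure. -/
lemma strongly_convex_closure {E : Type*} [NormedAddCommGroup E] [InnerProductSpace ℝ E]
    [CompleteSpace E] {f : E → ℝ} {Y : Set E} {q δ : ℝ} (hq : 0 ≤ q) (hf : Continuous f)
    (hg : Continuous (gradient f))
    (h : ∀ p₁ ∈ Y, ∀ p₂ ∈ Y, f p₁ - f p₂ ≥ ⟪gradient f p₂, p₁ - p₂⟫ + δ * ‖p₁ - p₂‖ ^ q) :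
    ∀ p₁ ∈ closure Y, ∀ p₂ ∈ closure Y,
      ⟪gradient f p₂, p₁ - p₂⟫ + δ * ‖p₁ - p₂‖ ^ q ≤ f p₁ - f p₂ := by
  have hclosed : IsClosed {w : E × E | ⟪gradient f w.2, w.1 - w.2⟫ + δ * ‖w.1 - w.2‖ ^ q ≤
      f w.1 - f w.2} := by
    refine isClosed_le ?_ (by fun_prop)
    have : Continuous fun w : E × E => ‖w.1 - w.2‖ ^ q := by fun_prop (disch := exact hq)
    fun_prop
  intro p₁ hp₁ p₂ hp₂
  have hsub : Y ×ˢ Y ⊆ {w : E × E | ⟪gradient f w.2, w.1 - w.2⟫ + δ * ‖w.1 - w.2‖ ^ q ≤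
      f w.1 - f w.2} := fun w hw => h w.1 hw.1 w.2 hw.2
  have hmem : ((p₁, p₂) : E × E) ∈ closure (Y ×ˢ Y) := by
    rw [closure_prod_eq]
    exact ⟨hp₁, hp₂⟩
  exact closure_minimal hsub hclosed hmem

lemma integrableOn_energy_density {F1 : EuclideanSpace ℝ (Fin n) → EuclideanSpace ℝ (Fin n) → ℝ}
    {F0 : EuclideanSpace ℝ (Fin n) → ℝ → ℝ} (hXb : Bornology.IsBounded X)
    (hXo : IsOpen X)
    (hF1 : Continuous fun z : EuclideanSpace ℝ (Fin n) × EuclideanSpace ℝ (Fin n) => F1 z.1 z.2)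
    (hF0 : Continuous fun z : EuclideanSpace ℝ (Fin n) × ℝ => F0 z.1 z.2)
    {v : EuclideanSpace ℝ (Fin n) → ℝ} {R : NNReal} (hv : LipschitzWith R v) :
    IntegrableOn (fun x => F1 x (gradient v x) + F0 x (v x)) X := by
  have hfin : IsFiniteMeasure ((volume : Measure (EuclideanSpace ℝ (Fin n))).restrict X) :=
    ⟨by simpa using hXb.measure_lt_top⟩
  refine Integrable.add ?_ ?_
  · obtain ⟨B, hB⟩ := (hXb.isCompact_closure.prod
      (isCompact_closedBall (0 : EuclideanSpace ℝ (Fin n)) R)).exists_bound_of_continuousOn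
      hF1.continuousOn
    refine Integrable.of_bound (hF1.measurable.comp
      (measurable_id.prodMk (measurable_gradient v))).aestronglyMeasurable B ?_
    filter_upwards [ae_restrict_mem hXo.measurableSet] with x hx
    refine hB (x, gradient v x) ⟨subset_closure hx, ?_⟩
    rw [mem_closedBall_zero_iff]
    exact norm_gradient_le_of_lipschitz hv x
  · have hc : Continuous fun x => F0 x (v x) := hF0.comp (continuous_id.prodMk hv.continuous)
    exact (hc.continuousOn.integrableOn_compact hXb.isCompact_closure).mono_set subset_closure

/-- The excess of a Lipschitz minimizer over its supporting affine functions decays like a power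
of the distance to the contact point, uniformly away from the boundary. -/
lemma excess_le_rpow_of_minimizer {a₀ : ℝ} {y₀ : EuclideanSpace ℝ (Fin n)} (hXo : IsOpen X)
    (hXb : Bornology.IsBounded X) (hYc : Convex ℝ Y)
    {F1 : EuclideanSpace ℝ (Fin n) → EuclideanSpace ℝ (Fin n) → ℝ}
    {F0 : EuclideanSpace ℝ (Fin n) → ℝ → ℝ} {q δ : ℝ} (hq : 1 < q) (hδ : 0 < δ)
    (hF1 : ContDiff ℝ 2 (fun z : EuclideanSpace ℝ (Fin n) × EuclideanSpace ℝ (Fin n) =>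
      F1 z.1 z.2))
    (hF0 : ContDiff ℝ 1 (fun z : EuclideanSpace ℝ (Fin n) × ℝ => F0 z.1 z.2))
    (H1 : ∀ x ∈ X, ∀ p₁ ∈ Y, ∀ p₂ ∈ Y,
      F1 x p₁ - F1 x p₂ ≥ ⟪gradient (F1 x) p₂, p₁ - p₂⟫ + δ * ‖p₁ - p₂‖ ^ q)
    (hu : admissible X Y a₀ y₀ u)
    (hmin : ∀ v, admissible X Y a₀ y₀ v → funcL X F1 F0 u ≤ funcL X F1 F0 v)
    {R : NNReal} (huR : LipschitzWith R u) (hR : ∀ y ∈ closure Y, ‖y‖ ≤ R)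
    {α : ℝ} (hα : α = if 2 < q then 1 / (q - 1) else 1) {d : ℝ} (hd : 0 < d) :
    ∃ C : ℝ, 0 ≤ C ∧ ∀ x₀, Metric.ball x₀ d ⊆ X → ∀ p ∈ subgrad X u x₀,
      ∀ z, ‖z - x₀‖ ≤ min 1 (d / 8) →
      u z - u x₀ - ⟪p, z - x₀⟫ ≤ C * ‖z - x₀‖ ^ (1 + α) := by
  have hYbdd : Bornology.IsBounded (closure Y) :=
    (Metric.isBounded_closedBall (x := 0) (r := (R : ℝ))).subset fun y hy =>
      mem_closedBall_zero_iff.2 (hR y hy)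
  have hV := contDiff_gradient_of_contDiff hF1
  obtain ⟨L, hL⟩ := hV.exists_lipschitzOnWith_of_isBounded (hXb.prod hYbdd)
  obtain ⟨M, hM⟩ := (hXb.isCompact_closure.prod
    hYbdd.isCompact_closure).exists_bound_of_continuousOn hV.continuous.continuousOn
  obtain ⟨B, hB⟩ := hXb.isCompact_closure.exists_bound_of_continuousOn huR.continuous.continuousOn
  obtain ⟨C₀, hC₀⟩ := hF0.exists_lipschitzOnWith_of_isBounded
    (hXb.prod (Metric.isBounded_Icc (-B) (B + 2 * R)))
  have hVp : ∀ p, Continuous fun x => gradient (F1 x) p := fun p =>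
    hV.continuous.comp (by fun_prop : Continuous fun x => (x, p))
  have hVL : ∀ p ∈ closure Y, LipschitzOnWith L (fun x => gradient (F1 x) p) X := by
    intro p hp
    refine LipschitzOnWith.of_dist_le_mul fun x hx y hy => ?_
    simpa [Prod.dist_eq] using hL.dist_le_mul (x, p) ⟨hx, hp⟩ (y, p) ⟨hy, hp⟩
  have hVM : ∀ p ∈ closure Y, ∀ x ∈ X, ‖gradient (F1 x) p‖ ≤ max M 0 := fun p hp x hx =>
    (hM (x, p) ⟨subset_closure hx, subset_closure hp⟩).trans (le_max_left _ _)
  have hF0L : ∀ x ∈ X, ∀ a, 0 ≤ a → a ≤ 2 * (R : ℝ) →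
      F0 x (u x + a) - F0 x (u x) ≤ C₀ * a := by
    intro x hx a ha haR
    have hux := abs_le.1 (hB x (subset_closure hx))
    have h1 := hC₀.dist_le_mul (x, u x + a) ⟨hx, by constructor <;> simp <;> linarith⟩
      (x, u x) ⟨hx, by constructor <;> simp <;> linarith [R.2]⟩
    simp only [Prod.dist_eq, dist_self, Real.dist_eq, add_sub_cancel_left, abs_of_nonneg ha,
      max_eq_right ha] at h1
    exact (le_abs_self _).trans h1
  have hstrong : ∀ x ∈ X, ∀ p₁ ∈ closure Y, ∀ p₂ ∈ closure Y,
      ⟪gradient (F1 x) p₂, p₁ - p₂⟫ + δ * ‖p₁ - p₂‖ ^ q ≤ F1 x p₁ - F1 x p₂ := fun x hx =>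
    strongly_convex_closure (by linarith)
      (hF1.continuous.comp (by fun_prop : Continuous fun p => (x, p)))
      (hV.continuous.comp (by fun_prop : Continuous fun p => (x, p))) (H1 x hx)
  set A : ℝ := 2 ^ n * ((max M 0 + 1) / d + n * ((max M 0 + 1) / d + L) + C₀)
  have hA : 0 ≤ A := by positivity
  refine ⟨(A * 16 ^ q / δ) ^ (1 / (q - 1)), by positivity, fun x₀ hball p hp z hz => ?_⟩
  rcases eq_or_ne z x₀ with rfl | hzx
  · simp only [sub_self, inner_zero_right]
    positivity
  have hr : 0 < ‖z - x₀‖ := norm_pos_iff.2 (sub_ne_zero.2 hzx)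
  have hr1 : ‖z - x₀‖ ≤ 1 := hz.trans (min_le_left _ _)
  have hrd : ‖z - x₀‖ ≤ d / 8 := hz.trans (min_le_right _ _)
  obtain ⟨h, hh0, hmax, hheight⟩ := section_height_le hXo hXb hYc hu.1 hu.2.1 huR hR
    (V := fun p x => gradient (F1 x) p) (fun p _ => hVp p) hVL (le_max_right M 0) hVM hq hδ C₀.2
    (fun p hp b hH => energy_excess_le hXo hXb hYc hq hstrong hu hmin huR hR
      (fun v _ hv => integrableOn_energy_density hXb hXo hF1.continuous hF0.continuous hv)
      hp (hVp p) b hF0L hH) hd hball hp hr hr1 (by linarith)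
  refine (hmax z (mem_closedBall_iff_norm.2 le_rfl)).trans ?_
  rcases hh0.eq_or_lt with h0 | hpos
  · rw [← h0]
    positivity
  · exact le_rpow_of_height_inequality hq hδ hA hpos hr hr1 hα (hheight hpos)

end Regularity

/-- **Interior `C^{1,α}` regularity of minimizers** (Theorem 1.5): under (H1)–(H3),
a minimizer of `L` over `U₀` is locally `C^{1,α}` with `α = 1/(q-1)` for `q > 2` and
`α = 1` for `1 < q ≤ 2`. -/
theorem interior_C1alpha_regularity {n : ℕ} (hn : 1 ≤ n)
    (X Y : Set (EuclideanSpace ℝ (Fin n)))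
    (hXo : IsOpen X) (hXb : Bornology.IsBounded X)
    (hYo : IsOpen Y) (hYb : Bornology.IsBounded Y) (hYc : Convex ℝ Y)
    (a₀ : ℝ) (y₀ : EuclideanSpace ℝ (Fin n)) (hy₀ : y₀ ∈ Y)
    (q δ : ℝ) (hq : 1 < q) (hδ : 0 < δ)
    (F1 : EuclideanSpace ℝ (Fin n) → EuclideanSpace ℝ (Fin n) → ℝ)
    (F0 : EuclideanSpace ℝ (Fin n) → ℝ → ℝ)
    (hF1 : ContDiff ℝ 2 (fun z : EuclideanSpace ℝ (Fin n) × EuclideanSpace ℝ (Fin n) =>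
      F1 z.1 z.2))
    (hF0 : ContDiff ℝ 1 (fun z : EuclideanSpace ℝ (Fin n) × ℝ => F0 z.1 z.2))
    -- (H1): for every `x ∈ X`, `p ↦ F¹(x,p)` is `(q,δ)`-strongly convex on `Y`
    (H1 : ∀ x ∈ X, ∀ p₁ ∈ Y, ∀ p₂ ∈ Y,
      F1 x p₁ - F1 x p₂ ≥ ⟪gradient (F1 x) p₂, p₁ - p₂⟫ + δ * ‖p₁ - p₂‖ ^ q)
    -- (H2): `|∂_z F⁰(x,z)| ≤ η(z)` with `η` locally bounded
    (η : ℝ → ℝ) (hη : ∀ K : Set ℝ, IsCompact K → ∃ M : ℝ, ∀ z ∈ K, |η z| ≤ M)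
    (H2 : ∀ x ∈ X, ∀ z : ℝ, |deriv (F0 x) z| ≤ η z)
    -- (H3): `|D_p F¹(x,p)| ≤ g(p)` and `|∂²F¹/∂xᵢ∂pᵢ(x,p)| ≤ g(p)` with `g` locally bounded on `Y`
    (g : EuclideanSpace ℝ (Fin n) → ℝ)
    (hg : ∀ K : Set (EuclideanSpace ℝ (Fin n)), K ⊆ Y → IsCompact K →
      ∃ M : ℝ, ∀ p ∈ K, |g p| ≤ M)
    (H3a : ∀ x ∈ X, ∀ p ∈ Y, ‖gradient (F1 x) p‖ ≤ g p)
    (H3b : ∀ x ∈ X, ∀ p ∈ Y, ∀ i : Fin n,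
      |fderiv ℝ (fun x' => ⟪gradient (F1 x') p, EuclideanSpace.single i 1⟫) x
        (EuclideanSpace.single i 1)| ≤ g p)
    (u : EuclideanSpace ℝ (Fin n) → ℝ) (hu : admissible X Y a₀ y₀ u)
    (hmin : ∀ v, admissible X Y a₀ y₀ v → funcL X F1 F0 u ≤ funcL X F1 F0 v)
    (α : ℝ) (hα : α = if 2 < q then 1 / (q - 1) else 1) :
    (∀ x ∈ X, DifferentiableAt ℝ u x) ∧
      ∀ K : Set (EuclideanSpace ℝ (Fin n)), K ⊆ X → IsCompact K →
        ∃ C : ℝ, ∀ x ∈ K, ∀ y ∈ K,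
          ‖gradient u x - gradient u y‖ ≤ C * ‖x - y‖ ^ α := by
  obtain ⟨R₀, hR₀⟩ := hYb.closure.exists_norm_le
  set R : NNReal := R₀.toNNReal
  have hR : ∀ y ∈ closure Y, ‖y‖ ≤ R := fun y hy => (hR₀ y hy).trans (Real.le_coe_toNNReal R₀)
  have hα0 : 0 < α := by
    rw [hα]
    split_ifs
    · exact one_div_pos.2 (by linarith)
    · exact one_pos
  obtain ⟨w, hwR, huw⟩ := (lipschitzOnWith_of_subgrad_subset hXo hu.1 hu.2.1 hR).extend_real
  have heq : ∀ x ∈ X, u =ᶠ[𝓝 x] w := fun x hx => huw.eventuallyEq_of_mem (hXo.mem_nhds hx)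
  have hsub : ∀ x ∈ X, subgrad X w x = subgrad X u x := fun x hx => by
    ext p
    refine forall₂_congr fun z hz => ?_
    rw [huw hx, huw hz]
  have hw : admissible X Y a₀ y₀ w :=
    ⟨hu.1.congr huw, fun x hx => hsub x hx ▸ hu.2.1 x hx,
      fun x hx => (hu.2.2 x hx).trans_eq (huw hx)⟩
  have hLw : funcL X F1 F0 w = funcL X F1 F0 u :=
    setIntegral_congr_fun hXo.measurableSet fun x hx => by
      simp only [huw hx, (heq x hx).gradient_eq]
  have hdecay : ∀ d > 0, ∃ C : ℝ, 0 ≤ C ∧ ∀ x, Metric.ball x d ⊆ X → ∀ p ∈ subgrad X u x,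
      ∀ z, ‖z - x‖ ≤ min 1 (d / 8) → u z - u x - ⟪p, z - x⟫ ≤ C * ‖z - x‖ ^ (1 + α) := by
    intro d hd
    obtain ⟨C, hC0, hC⟩ := excess_le_rpow_of_minimizer hXo hXb hYc hq hδ hF1 hF0 H1 hw
      (fun v hv => hLw.trans_le (hmin v hv)) hwR hR hα hd
    refine ⟨C, hC0, fun x hball p hp z hz => ?_⟩
    have hx : x ∈ X := hball (Metric.mem_ball_self hd)
    have hzX : z ∈ X := hball (mem_ball_iff_norm.2
      (hz.trans_lt ((min_le_right _ _).trans_lt (by linarith))))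
    rw [huw hx, huw hzX]
    exact hC x hball p (hsub x hx ▸ hp) z hz
  have hgrad : ∀ x ∈ X, DifferentiableAt ℝ u x := by
    intro x hx
    obtain ⟨d, hd, hball⟩ := Metric.isOpen_iff.1 hXo x hx
    obtain ⟨C, -, hC⟩ := hdecay d hd
    obtain ⟨p, hp⟩ := subgrad_nonempty hXo hu.1 hx
    exact (hasGradientAt_of_excess_le hXo hx hp (by positivity) hα0
      (hC x hball p hp)).differentiableAt
  refine ⟨hgrad, fun K hKX hK => ?_⟩
  have hsg : ∀ x ∈ K, gradient u x ∈ subgrad X u x := fun x hx =>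
    gradient_mem_subgrad hu.1 (hKX hx) (hgrad x (hKX hx))
  obtain ⟨d, hd, hthick⟩ := hK.exists_thickening_subset_open hXo hKX
  have hball : ∀ x ∈ K, Metric.ball x d ⊆ X := fun x hx =>
    (Metric.ball_subset_thickening hx d).trans hthick
  obtain ⟨C, hC0, hC⟩ := hdecay d hd
  set r₀ := min 1 (d / 8)
  have hr₀ : 0 < r₀ := by positivity
  have hr₀d : r₀ < d := (min_le_right _ _).trans_lt (by linarith)
  refine ⟨C * 2 ^ (1 + α) + 2 * R * (2 / r₀) ^ α, fun x hx y hy => ?_⟩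
  rcases eq_or_ne x y with rfl | hxy
  · rw [sub_self, norm_zero]
    positivity
  rw [add_mul]
  rcases le_or_gt (2 * ‖x - y‖) r₀ with hle | hgt
  · refine (norm_subgrad_sub_le (hKX hx) (hsg x hx) (hsg y hy) hC0 hxy hle
      ((Metric.closedBall_subset_ball hr₀d).trans (hball y hy)) hα0
      (hC y (hball y hy) _ (hsg y hy))).trans (le_add_of_nonneg_right (by positivity))
  · have h1 : 1 ≤ (2 / r₀) ^ α * ‖x - y‖ ^ α := by
      rw [← Real.mul_rpow (by positivity) (norm_nonneg _)]
      refine Real.one_le_rpow ?_ hα0.le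
      rw [div_mul_eq_mul_div, one_le_div hr₀]
      exact hgt.le
    have h2 : ‖gradient u x - gradient u y‖ ≤ 2 * R := by
      have hx' := hR _ (hu.2.1 x (hKX hx) (hsg x hx))
      have hy' := hR _ (hu.2.1 y (hKX hy) (hsg y hy))
      linarith [norm_sub_le (gradient u x) (gradient u y)]
    calc ‖gradient u x - gradient u y‖ ≤ 2 * R * 1 := by rwa [mul_one]
      _ ≤ 2 * R * ((2 / r₀) ^ α * ‖x - y‖ ^ α) := by gcongr
      _ = 2 * R * (2 / r₀) ^ α * ‖x - y‖ ^ α := by ring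
      _ ≤ _ := le_add_of_nonneg_left (by positivity)
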